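/- Let p > 1 and 0 < δ < 1/2, and let E = ⋃_{n∈ℤ} [|n|^p·sgn(n) − δ, |n|^p·sgn(n) + δ]. Let W be a weight with W(x) = +∞ for every x ∈ ℝ∖E. If the polynomials are not dense in C(W), then ∫_E log M_W(x)/(1 + |x|^{1+1/p}) dx < ∞. -/

import Mathlib

open Complex Filter Set MeasureTheory
open scoped ENNReal

noncomputable def logPlus (t : ℝ) : ℝ := max (Real.log t) 0

/-- `W` is a weight: lower semicontinuous, `≥ 1`, dominating all powers,
and finite on a set with a finite accumulation point. -/
def IsWeight (W : ℝ → ℝ≥0∞) : Prop :=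
  LowerSemicontinuous W ∧ (∀ x, 1 ≤ W x) ∧
  (∀ n : ℕ, Tendsto (fun x : ℝ => ENNReal.ofReal (|x| ^ n) / W x)
    (comap (fun x : ℝ => |x|) atTop) (nhds 0)) ∧
  ∃ x₀ : ℝ, AccPt x₀ (Filter.principal {x | W x ≠ ⊤})

/-- Membership in the space `C(W)`. -/
def MemCW (W : ℝ → ℝ≥0∞) (f : ℝ → ℂ) : Prop :=
  Continuous f ∧
  Tendsto (fun x : ℝ => ENNReal.ofReal ‖f x‖ / W x)
    (comap (fun x : ℝ => |x|) atTop) (nhds 0)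

/-- The norm of `C(W)`. -/
noncomputable def normCW (W : ℝ → ℝ≥0∞) (f : ℝ → ℂ) : ℝ≥0∞ :=
  ⨆ x : ℝ, ENNReal.ofReal ‖f x‖ / W x

/-- The polynomials are dense in `C(W)`. -/
def PolyDense (W : ℝ → ℝ≥0∞) : Prop :=
  ∀ f : ℝ → ℂ, MemCW W f → ∀ ε : ℝ, 0 < ε →
    ∃ P : Polynomial ℂ, normCW W (fun x => f x - P.eval (x : ℂ)) < ENNReal.ofReal ε

/-- The unit ball `X_W`: polynomials bounded by `W` on `ℝ`. -/
def XW (W : ℝ → ℝ≥0∞) : Set (Polynomial ℂ) :=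
  {P | ∀ x : ℝ, ENNReal.ofReal ‖P.eval (x : ℂ)‖ ≤ W x}

/-- The Hall majorant `M_W`. -/
noncomputable def MW (W : ℝ → ℝ≥0∞) (z : ℂ) : ℝ≥0∞ :=
  ⨆ P ∈ XW W, ENNReal.ofReal ‖P.eval z‖

/-- Logarithm on `[1,+∞]`, with `elog ⊤ = ⊤`. -/
noncomputable def elog (w : ℝ≥0∞) : ℝ≥0∞ :=
  if w = ⊤ then ⊤ else ENNReal.ofReal (Real.log w.toReal)



lemma jensen_le {f : ℂ → ℂ} {r : ℝ} (hr : 0 < r) (hm : MeromorphicOn f (Metric.closedBall 0 r))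
    (ha : AnalyticOnNhd ℂ f (Metric.ball 0 r)) (h0 : f 0 ≠ 0) :
    Real.log ‖f 0‖ ≤ Real.circleAverage (fun z => Real.log ‖f z‖) 0 r := by
  have hm' : MeromorphicOn f (Metric.closedBall 0 |r|) := by rwa [abs_of_pos hr]
  have ha0 : AnalyticAt ℂ f 0 := ha 0 (by simpa using hr)
  rw [MeromorphicOn.circleAverage_log_norm hr.ne' hm',
    ha0.meromorphicTrailingCoeffAt_of_ne_zero h0]
  have h1 : MeromorphicOn.divisor f (Metric.closedBall 0 |r|) 0 = 0 := by
    rw [MeromorphicOn.divisor_apply hm' (by simp)]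
    have : meromorphicOrderAt f 0 = 0 := by
      rw [ha0.meromorphicOrderAt_eq, ha0.analyticOrderAt_eq_zero.2 h0]; rfl
    rw [this]; rfl
  rw [h1]
  have : 0 ≤ ∑ᶠ u, MeromorphicOn.divisor f (Metric.closedBall 0 |r|) u * Real.log (r * ‖0 - u‖⁻¹) := by
    apply finsum_nonneg
    intro u
    rw [zero_sub, norm_neg]
    by_cases hu : ‖u‖ < r
    · by_cases hu0 : u = 0
      · simp [hu0]
      have hpos : 0 < ‖u‖ := norm_pos_iff.2 hu0
      apply mul_nonneg
      · have hau : AnalyticAt ℂ f u := ha u (by simpa using hu)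
        rw [MeromorphicOn.divisor_apply hm' (by simp [abs_of_pos hr, hu.le])]
        have := hau.meromorphicOrderAt_nonneg
        exact_mod_cast WithTop.untop₀_nonneg.2 this
      · apply Real.log_nonneg
        rw [← div_eq_mul_inv, le_div_iff₀ hpos]; linarith
    · by_cases hu2 : ‖u‖ = r
      · rw [hu2, mul_inv_cancel₀ hr.ne']; simp
      · rw [Function.locallyFinsuppWithin.apply_eq_zero_of_notMem]
        · simp
        · simp only [Metric.mem_closedBall, dist_zero_right, abs_of_pos hr]
          intro h; exact hu (lt_of_le_of_ne h hu2)
  simp only [Int.cast_zero, zero_mul]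
  linarith

/-- substitution -/
lemma subst_circle (x h : ℝ) (hh : h ≠ 0) (G : ℂ → ℝ≥0∞) :
    ∫⁻ θ in Ioo 0 (2 * Real.pi), G (circleMap 0 1 θ) =
      ∫⁻ t, ENNReal.ofReal (2 * |h| / (h ^ 2 + (t - x) ^ 2)) *
        G (-(1 + I * ((t - x) / h : ℝ)) / (1 - I * ((t - x) / h : ℝ))) := by
  let φ : ℝ → ℝ := fun t => Real.pi + 2 * Real.arctan ((t - x) / h)
  have himg : φ '' univ = Ioo 0 (2 * Real.pi) := by
    ext θ
    simp only [mem_image, mem_univ, true_and, mem_Ioo]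
    constructor
    · rintro ⟨t, rfl⟩
      have := Real.neg_pi_div_two_lt_arctan ((t - x) / h)
      have := Real.arctan_lt_pi_div_two ((t - x) / h)
      simp only [φ]
      constructor <;> linarith
    · rintro ⟨h1, h2⟩
      refine ⟨x + h * Real.tan ((θ - Real.pi) / 2), ?_⟩
      simp only [φ]
      have : (x + h * Real.tan ((θ - Real.pi) / 2) - x) / h = Real.tan ((θ - Real.pi) / 2) := by
        field_simp; ring
      rw [this, Real.arctan_tan (by linarith) (by linarith)]; ring
  have hinj : InjOn φ univ := by
    intro a _ b _ hab
    simp only [φ] at hab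
    have : Real.arctan ((a - x) / h) = Real.arctan ((b - x) / h) := by linarith
    have := Real.arctan_injective this
    field_simp at this
    linarith
  have hd : ∀ t ∈ (univ : Set ℝ), HasDerivWithinAt φ (2 * h / (h ^ 2 + (t - x) ^ 2)) univ t := by
    intro t _
    have h1 : HasDerivAt (fun t : ℝ => (t - x) / h) (1 / h) t :=
      ((hasDerivAt_id t).sub_const x).div_const h
    have h2 := (h1.arctan.const_mul 2).const_add Real.pi
    have h3 : 0 < h ^ 2 + (t - x) ^ 2 := by positivity
    have h4 : 1 + ((t - x) / h) ^ 2 = (h ^ 2 + (t - x) ^ 2) / h ^ 2 := by field_simp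
    have h5 : 2 * (1 / (1 + ((t - x) / h) ^ 2) * (1 / h)) = 2 * h / (h ^ 2 + (t - x) ^ 2) := by
      rw [h4]
      field_simp
    rw [← h5]
    exact h2.hasDerivWithinAt
  rw [← himg, lintegral_image_eq_lintegral_abs_deriv_mul MeasurableSet.univ hd hinj,
    Measure.restrict_univ]
  congr 1
  ext t
  congr 2
  · have h3 : 0 < h ^ 2 + (t - x) ^ 2 := by positivity
    rw [abs_div, abs_mul, abs_of_pos h3]; simp
  · simp only [φ]
    set s := (t - x) / h
    have hc : (1 - I * (s : ℂ)) ≠ 0 := by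
      intro h0
      have := congrArg Complex.re h0
      simp at this
    have hs : (0 : ℝ) < 1 + s ^ 2 := by positivity
    have hs' : (1 + (s : ℂ) ^ 2) ≠ 0 := by exact_mod_cast hs.ne'
    have e1 : Real.cos (2 * Real.arctan s) = (1 - s ^ 2) / (1 + s ^ 2) := by
      rw [Real.cos_two_mul, Real.cos_sq_arctan]; field_simp; ring
    have e2 : Real.sin (2 * Real.arctan s) = 2 * s / (1 + s ^ 2) := by
      rw [Real.sin_two_mul, Real.sin_arctan, Real.cos_arctan]
      have : Real.sqrt (1 + s ^ 2) ^ 2 = 1 + s ^ 2 := Real.sq_sqrt hs.le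
      field_simp
      rw [this]
    rw [circleMap, zero_add, ofReal_one, one_mul]
    simp only [ofReal_add, ofReal_mul, ofReal_ofNat]
    rw [add_mul, Complex.exp_add, Complex.exp_pi_mul_I, Complex.exp_mul_I]
    have e1' : Complex.cos (2 * (Real.arctan s : ℂ)) = (1 - s ^ 2) / (1 + s ^ 2) := by
      exact_mod_cast congrArg (fun x : ℝ => (x : ℂ)) e1
    have e2' : Complex.sin (2 * (Real.arctan s : ℂ)) = 2 * s / (1 + s ^ 2) := by
      exact_mod_cast congrArg (fun x : ℝ => (x : ℂ)) e2
    rw [e1', e2']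
    rw [eq_div_iff hc]
    field_simp
    linear_combination (2 * s ^ 2 : ℂ) * I_sq

lemma ofReal_integral_le_aux {f : ℝ → ℝ} {μ : Measure ℝ} (hf : Integrable f μ) :
    ENNReal.ofReal (∫ x, f x ∂μ) ≤ ∫⁻ x, ENNReal.ofReal (f x) ∂μ := by
  have h1 : Integrable (fun x => max (f x) 0) μ := hf.pos_part
  calc ENNReal.ofReal (∫ x, f x ∂μ) ≤ ENNReal.ofReal (∫ x, max (f x) 0 ∂μ) :=
        ENNReal.ofReal_le_ofReal (integral_mono hf h1 (fun x => le_max_left _ _))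
    _ = ∫⁻ x, ENNReal.ofReal (max (f x) 0) ∂μ :=
        ofReal_integral_eq_lintegral_ofReal h1 (ae_of_all _ fun x => le_max_right _ _)
    _ = _ := by
        congr 1; ext x
        rcases le_total (f x) 0 with h | h
        · rw [max_eq_right h, ENNReal.ofReal_zero, ENNReal.ofReal_of_nonpos h]
        · rw [max_eq_left h]

lemma circleAverage_eq_aux (f : ℂ → ℝ) (r : ℝ) : Real.circleAverage f 0 r =
    (2 * Real.pi)⁻¹ * ∫ θ in Ioo 0 (2 * Real.pi), f (circleMap 0 r θ) := by
  rw [Real.circleAverage, intervalIntegral.integral_of_le (by positivity), smul_eq_mul,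
    integral_Ioc_eq_integral_Ioo]

lemma circleInt_aux {f : ℂ → ℝ} {r : ℝ} (h : CircleIntegrable f 0 r) :
    Integrable (fun θ => f (circleMap 0 r θ)) (volume.restrict (Ioo 0 (2 * Real.pi))) := by
  have := (intervalIntegrable_iff_integrableOn_Ioo_of_le (by positivity)).1 h
  exact this

lemma jensen_lintegral {f : ℂ → ℂ} {r : ℝ} (hr : 0 < r)
    (hm : MeromorphicOn f (Metric.closedBall 0 r))
    (ha : AnalyticOnNhd ℂ f (Metric.ball 0 r)) (h0 : f 0 ≠ 0) :
    ENNReal.ofReal (2 * Real.pi) * ENNReal.ofReal (Real.log ‖f 0‖) ≤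
      ∫⁻ θ in Ioo 0 (2 * Real.pi), ENNReal.ofReal (Real.log ‖f (circleMap 0 r θ)‖) := by
  have h1 := jensen_le hr hm ha h0
  have hci : CircleIntegrable (fun z => Real.log ‖f z‖) 0 r :=
    MeromorphicOn.circleIntegrable_log_norm
      (fun z hz => hm z (by rw [abs_of_pos hr] at hz; exact Metric.sphere_subset_closedBall hz))
  rw [circleAverage_eq_aux] at h1
  refine le_trans ?_ (ofReal_integral_le_aux (circleInt_aux hci))
  rw [← ENNReal.ofReal_mul (by positivity)]
  apply ENNReal.ofReal_le_ofReal
  have hp : 0 < 2 * Real.pi := by positivity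
  have := mul_le_mul_of_nonneg_left h1 hp.le
  rwa [← mul_assoc, mul_inv_cancel₀ hp.ne', one_mul] at this

lemma cayley_im {ζ : ℂ} (h1 : ζ ≠ 1) (h : ‖ζ‖ ≤ 1) : 0 ≤ (I * ((1 + ζ) / (1 - ζ))).im := by
  have h2 : Complex.normSq ζ ≤ 1 := by
    rw [Complex.normSq_eq_norm_sq]; nlinarith [norm_nonneg ζ]
  have h3 : 0 < Complex.normSq (1 - ζ) := Complex.normSq_pos.2 (sub_ne_zero.2 h1.symm)
  rw [I_mul_im, Complex.div_re]
  rw [← add_div]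
  apply div_nonneg _ h3.le
  rw [Complex.normSq_apply] at h2
  simp
  nlinarith

lemma cayley_bd (s : ℝ) :
    (1 + (-(1 + I * (s : ℂ)) / (1 - I * (s : ℂ)))) / (1 - (-(1 + I * (s : ℂ)) / (1 - I * (s : ℂ))))
      = - I * s := by
  have hc : (1 - I * (s : ℂ)) ≠ 0 := by
    intro h0
    have := congrArg Complex.re h0
    simp at this
  have : (1 - (-(1 + I * (s : ℂ)) / (1 - I * (s : ℂ)))) = 2 / (1 - I * s) := by
    field_simp; ring
  rw [this]
  field_simp; ring

lemma poly_poisson (Q : Polynomial ℂ) (x h : ℝ) (hh : 0 < h) :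
    ENNReal.ofReal (Real.log ‖Q.eval ((x : ℂ) + I - I * h)‖) ≤
      ∫⁻ t : ℝ, ENNReal.ofReal (h / (h ^ 2 + (t - x) ^ 2)) *
        ENNReal.ofReal (Real.log ‖Q.eval ((t : ℂ) + I)‖) := by
  by_cases h0 : Q.eval ((x : ℂ) + I - I * h) = 0
  · simp [h0]
  let f : ℂ → ℂ := fun ζ => Q.eval ((x : ℂ) + I - I * h * ((1 + ζ) / (1 - ζ)))
  have hf0 : f 0 = Q.eval ((x : ℂ) + I - I * h) := by simp [f]
  have hpe : ∀ z, AnalyticAt ℂ (fun z => Q.eval z) z := fun z => by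
    simpa using AnalyticOnNhd.eval_polynomial Q z (mem_univ _)
  have ha : AnalyticOnNhd ℂ f (Metric.ball 0 1) := by
    intro ζ hζ
    have h1 : 1 - ζ ≠ 0 := by
      intro h; rw [sub_eq_zero] at h; subst h; simp at hζ
    apply (hpe _).fun_comp (f := fun ζ : ℂ => (x : ℂ) + I - I * h * ((1 + ζ) / (1 - ζ)))
    fun_prop (disch := assumption)
  have hm : MeromorphicOn f (Metric.closedBall 0 1) := by
    intro ζ _
    have hz : MeromorphicAt (fun ζ : ℂ => (x : ℂ) + I - I * h * ((1 + ζ) / (1 - ζ))) ζ := by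
      fun_prop
    have : f = fun ζ => ∑ n ∈ Q.support, Q.coeff n * ((x : ℂ) + I - I * h * ((1 + ζ) / (1 - ζ))) ^ n := by
      ext ζ; simp only [f, Polynomial.eval_eq_sum, Polynomial.sum]
    rw [this]
    fun_prop
  have key := jensen_lintegral one_pos hm ha (by rwa [hf0])
  rw [hf0] at key
  have hsub := subst_circle x (-h) (by linarith) (fun ζ => ENNReal.ofReal (Real.log ‖f ζ‖))
  rw [hsub] at key
  have e : ∀ t : ℝ, ENNReal.ofReal (2 * |-h| / ((-h) ^ 2 + (t - x) ^ 2)) *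
      ENNReal.ofReal (Real.log ‖f (-(1 + I * ((t - x) / (-h) : ℝ)) / (1 - I * ((t - x) / (-h) : ℝ)))‖)
      = ENNReal.ofReal 2 * (ENNReal.ofReal (h / (h ^ 2 + (t - x) ^ 2)) *
        ENNReal.ofReal (Real.log ‖Q.eval ((t : ℂ) + I)‖)) := by
    intro t
    rw [← mul_assoc, ← ENNReal.ofReal_mul (p := 2) (by norm_num)]
    congr 2
    · rw [abs_neg, abs_of_pos hh]; ring_nf
    · simp only [f]
      rw [cayley_bd]
      congr 4
      have : (h : ℂ) ≠ 0 := by exact_mod_cast hh.ne'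
      push_cast
      field_simp
      linear_combination -(t - x : ℂ) * I_sq
  simp_rw [e] at key
  rw [lintegral_const_mul' _ _ ENNReal.ofReal_ne_top, ENNReal.ofReal_mul (by norm_num), mul_assoc,
    ENNReal.mul_le_mul_iff_right (by simp) ENNReal.ofReal_ne_top] at key
  refine le_trans ?_ key
  calc _ = 1 * ENNReal.ofReal (Real.log ‖Q.eval ((x : ℂ) + I - I * h)‖) := (one_mul _).symm
    _ ≤ _ := by
      gcongr
      rw [ENNReal.one_le_ofReal]
      linarith [Real.pi_gt_three]

noncomputable def nlog (K : ℝ) (w : ℂ) : ℝ≥0∞ :=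
  if w = 0 then ⊤ else ENNReal.ofReal (Real.log K - Real.log ‖w‖)

lemma continuous_nlog (K : ℝ) : Continuous (nlog K) := by
  rw [continuous_iff_continuousAt]
  intro w
  by_cases hw : w = 0
  · subst hw
    rw [ContinuousAt, show nlog K 0 = ⊤ by simp [nlog]]
    rw [ENNReal.tendsto_nhds_top_iff_nnreal]
    intro a
    have h1 : Tendsto (fun w : ℂ => Real.log ‖w‖) (nhdsWithin 0 {0}ᶜ) atBot :=
      Real.tendsto_log_nhdsNE_zero.comp (tendsto_norm_nhdsNE_zero.mono_right (nhdsWithin_mono _ (by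
        intro y hy; exact ne_of_gt hy)))
    have h2 := h1.eventually (eventually_lt_atBot (Real.log K - a - 1))
    rw [eventually_nhdsWithin_iff] at h2
    filter_upwards [h2] with w hw
    unfold nlog
    split_ifs with h0
    · simp
    · have := hw h0
      rw [ENNReal.lt_ofReal_iff_toReal_lt (by simp)]
      simp; linarith
  · have h1 : ContinuousAt (fun w : ℂ => ENNReal.ofReal (Real.log K - Real.log ‖w‖)) w := by
      apply ENNReal.continuous_ofReal.continuousAt.comp
      apply continuousAt_const.sub
      exact (Real.continuousAt_log (by simpa using hw)).comp continuous_norm.continuousAt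
    apply h1.congr
    filter_upwards [isOpen_ne.mem_nhds hw] with v hv
    have : v ≠ 0 := hv
    simp [nlog, this]

lemma nlog_fatou {g : ℂ → ℂ} {K : ℝ} (hK : 1 ≤ K) (ha : AnalyticOnNhd ℂ g (Metric.ball 0 1))
    (hb : ∀ ζ ∈ Metric.ball (0 : ℂ) 1, ‖g ζ‖ ≤ K) (h0 : g 0 ≠ 0)
    (hc : ∀ θ ∈ Ioo 0 (2 * Real.pi), ContinuousAt g (circleMap 0 1 θ)) :
    ∫⁻ θ in Ioo 0 (2 * Real.pi), nlog K (g (circleMap 0 1 θ)) < ⊤ := by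
  let r : ℕ → ℝ := fun n => 1 - 1 / ((n : ℝ) + 2)
  have hr0 : ∀ n, 0 < r n := fun n => by
    simp only [r, sub_pos]
    rw [div_lt_one (by positivity)]; linarith [Nat.cast_nonneg (α := ℝ) n]
  have hr1 : ∀ n, r n < 1 := fun n => by
    simp only [r]; have : 0 < 1 / ((n : ℝ) + 2) := by positivity
    linarith
  have hrt : Tendsto r atTop (nhds 1) := by
    have : Tendsto (fun n : ℕ => 1 / ((n : ℝ) + 2)) atTop (nhds 0) :=
      tendsto_const_nhds.div_atTop (tendsto_atTop_add_const_right _ _ tendsto_natCast_atTop_atTop)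
    have h := (tendsto_const_nhds (x := (1 : ℝ))).sub this
    rw [sub_zero] at h
    exact h
  have hcirc : ∀ n θ, circleMap 0 (r n) θ ∈ Metric.ball (0 : ℂ) 1 := fun n θ => by
    simp [abs_of_pos (hr0 n), hr1 n]
  -- bound for each n
  have hbd : ∀ n, ∫⁻ θ in Ioo 0 (2 * Real.pi), nlog K (g (circleMap 0 (r n) θ)) ≤
      ENNReal.ofReal (2 * Real.pi * (Real.log K - Real.log ‖g 0‖)) := by
    intro n
    have hsub : Metric.closedBall (0 : ℂ) (r n) ⊆ Metric.ball 0 1 :=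
      Metric.closedBall_subset_ball (hr1 n)
    have hm : MeromorphicOn g (Metric.closedBall 0 (r n)) := fun z hz =>
      (ha z (hsub hz)).meromorphicAt
    have hj := jensen_le (hr0 n) hm (ha.mono (Metric.ball_subset_closedBall.trans hsub)) h0
    have hci : CircleIntegrable (fun z => Real.log ‖g z‖) 0 (r n) :=
      MeromorphicOn.circleIntegrable_log_norm
        (fun z hz => hm z (by rw [abs_of_pos (hr0 n)] at hz; exact Metric.sphere_subset_closedBall hz))
    have hint := circleInt_aux hci
    rw [circleAverage_eq_aux] at hj
    have hzero : ∀ᵐ θ ∂(volume.restrict (Ioo 0 (2 * Real.pi))), g (circleMap 0 (r n) θ) ≠ 0 := by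
      have hcod := ha.preimage_zero_mem_codiscreteWithin (x := 0) h0 (by simp)
        (Metric.isConnected_ball one_pos)
      have h1 := circleMap_preimage_codiscrete (c := 0) (hr0 n).ne'
        (codiscreteWithin_mono (U := Metric.ball 0 1) (by
          rw [abs_of_pos (hr0 n)]; exact Metric.sphere_subset_closedBall.trans hsub) hcod)
      rw [mem_map] at h1
      exact ae_restrict_le_codiscreteWithin measurableSet_Ioo
        (codiscreteWithin_mono (subset_univ _) h1)
    have e1 : ∫⁻ θ in Ioo 0 (2 * Real.pi), nlog K (g (circleMap 0 (r n) θ)) =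
        ∫⁻ θ in Ioo 0 (2 * Real.pi),
          ENNReal.ofReal (Real.log K - Real.log ‖g (circleMap 0 (r n) θ)‖) := by
      apply lintegral_congr_ae
      filter_upwards [hzero] with θ hθ
      simp [nlog, hθ]
    have hKi : Integrable (fun _ : ℝ => Real.log K) (volume.restrict (Ioo 0 (2 * Real.pi))) :=
      integrable_const _
    rw [e1, ← ofReal_integral_eq_lintegral_ofReal (f := fun θ => Real.log K -
      Real.log ‖g (circleMap 0 (r n) θ)‖) (hKi.sub hint)]
    · apply ENNReal.ofReal_le_ofReal
      rw [integral_sub hKi hint]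
      have hp : 0 < 2 * Real.pi := by positivity
      have := mul_le_mul_of_nonneg_left hj hp.le
      rw [← mul_assoc, mul_inv_cancel₀ hp.ne', one_mul] at this
      simp only [integral_const, smul_eq_mul]
      rw [measureReal_restrict_apply_univ, Real.volume_real_Ioo_of_le hp.le]
      linarith
    · apply ae_of_all
      intro θ
      simp only [Pi.zero_apply, Pi.sub_apply, sub_nonneg]
      by_cases hz : g (circleMap 0 (r n) θ) = 0
      · simp [hz, Real.log_nonneg hK]
      · exact Real.log_le_log (norm_pos_iff.2 hz) (hb _ (hcirc n θ))
  have hmeas : ∀ n, Measurable (fun θ => nlog K (g (circleMap 0 (r n) θ))) := by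
    intro n
    apply Continuous.measurable
    apply (continuous_nlog K).comp
    exact ha.continuousOn.comp_continuous (continuous_circleMap 0 (r n)) (hcirc n)
  calc ∫⁻ θ in Ioo 0 (2 * Real.pi), nlog K (g (circleMap 0 1 θ))
      = ∫⁻ θ in Ioo 0 (2 * Real.pi), liminf (fun n => nlog K (g (circleMap 0 (r n) θ))) atTop := by
        apply setLIntegral_congr_fun measurableSet_Ioo
        intro θ hθ
        have : Tendsto (fun n => nlog K (g (circleMap 0 (r n) θ))) atTop
            (nhds (nlog K (g (circleMap 0 1 θ)))) := by
          apply ((continuous_nlog K).tendsto _).comp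
          apply (hc θ hθ).tendsto.comp
          have : Continuous (fun ρ : ℝ => circleMap 0 ρ θ) := by unfold circleMap; fun_prop
          exact (this.tendsto 1).comp hrt
        exact this.liminf_eq.symm
    _ ≤ liminf (fun n => ∫⁻ θ in Ioo 0 (2 * Real.pi), nlog K (g (circleMap 0 (r n) θ))) atTop :=
        lintegral_liminf_le hmeas
    _ ≤ liminf (fun n : ℕ => ENNReal.ofReal (2 * Real.pi * (Real.log K - Real.log ‖g 0‖))) atTop :=
        liminf_le_liminf (Eventually.of_forall hbd)
    _ < ⊤ := by simp

lemma F_poisson {F : ℂ → ℂ} {K : ℝ} (hK : 1 ≤ K) (hd : DifferentiableOn ℂ F {z | 0 < z.im})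
    (hb : ∀ z : ℂ, 1 ≤ z.im → ‖F z‖ ≤ K) (h0 : F (2 * I) ≠ 0) :
    ∫⁻ t : ℝ, ENNReal.ofReal (1 / (1 + t ^ 2)) * nlog K (F (t + I)) < ⊤ := by
  let c : ℂ → ℂ := fun ζ => I + I * ((1 + ζ) / (1 - ζ))
  have hcim : ∀ ζ : ℂ, ζ ≠ 1 → ‖ζ‖ ≤ 1 → 1 ≤ (c ζ).im := fun ζ h1 h2 => by
    simp only [c, add_im, I_im]
    linarith [cayley_im h1 h2]
  have hFa : AnalyticOnNhd ℂ F {z | 0 < z.im} :=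
    hd.analyticOnNhd (isOpen_lt continuous_const Complex.continuous_im)
  have han : ∀ ζ : ℂ, ζ ≠ 1 → ‖ζ‖ ≤ 1 → AnalyticAt ℂ (fun ζ => F (c ζ)) ζ := by
    intro ζ h1 h2
    have h3 : 1 - ζ ≠ 0 := sub_ne_zero.2 h1.symm
    apply (hFa (c ζ) (by have := hcim ζ h1 h2; simp only [mem_ofPred_eq]; linarith)).fun_comp
    simp only [c]
    fun_prop (disch := assumption)
  have hne : ∀ ζ ∈ Metric.ball (0 : ℂ) 1, ζ ≠ 1 ∧ ‖ζ‖ ≤ 1 := by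
    intro ζ hζ
    rw [mem_ball_zero_iff] at hζ
    refine ⟨?_, hζ.le⟩
    rintro rfl
    simp at hζ
  have := nlog_fatou (g := fun ζ => F (c ζ)) hK (fun ζ hζ => han ζ (hne ζ hζ).1 (hne ζ hζ).2)
    (fun ζ hζ => hb _ (hcim ζ (hne ζ hζ).1 (hne ζ hζ).2))
    (by simpa [c, ← two_mul] using h0)
    (by
      intro θ hθ
      apply (han _ _ _).continuousAt
      · intro h
        rw [circleMap, zero_add, ofReal_one, one_mul, Complex.exp_eq_one_iff] at h
        obtain ⟨n, hn⟩ := h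
        have h3 : (θ : ℂ) = n * (2 * Real.pi) := by
          apply mul_right_cancel₀ I_ne_zero
          rw [hn]; ring
        have h4 : θ = n * (2 * Real.pi) := by exact_mod_cast h3
        rw [h4] at hθ
        have hp : 0 < 2 * Real.pi := by positivity
        have h5 : (0 : ℝ) < n := by
          by_contra h; push Not at h; nlinarith [hθ.1]
        have h6 : (n : ℝ) < 1 := by
          by_contra h; push Not at h; nlinarith [hθ.2]
        have h7 : 0 < n := by exact_mod_cast h5
        have h8 : n < 1 := by exact_mod_cast h6
        omega
      · simp)
  rw [subst_circle 0 1 one_ne_zero (fun ζ => nlog K (F (c ζ)))] at this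
  refine lt_of_le_of_lt (lintegral_mono fun t => ?_) this
  simp only [sub_zero, div_one, abs_one, mul_one, one_pow]
  gcongr
  · norm_num
  · simp only [c]
    rw [cayley_bd]
    apply le_of_eq
    congr 2
    linear_combination (t : ℂ) * I_sq

noncomputable abbrev LL := lp (fun _ : ℝ => ℂ) ∞

noncomputable def mkL (f : ℝ → ℂ) (h : ∃ C : ℝ, ∀ t, ‖f t‖ ≤ C) : LL :=
  ⟨f, memℓp_infty (by obtain ⟨C, hC⟩ := h; exact ⟨C, by rintro _ ⟨t, rfl⟩; exact hC t⟩)⟩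

@[simp] lemma mkL_apply (f : ℝ → ℂ) (h) (t : ℝ) : mkL f h t = f t := rfl

lemma LL_norm_le {x : LL} {C : ℝ} (hC : 0 ≤ C) (h : ∀ t, ‖x t‖ ≤ C) : ‖x‖ ≤ C :=
  lp.norm_le_of_forall_le hC h

lemma LL_apply_le (x : LL) (t : ℝ) : ‖x t‖ ≤ ‖x‖ :=
  lp.norm_apply_le_norm (by simp) x t

lemma LL_mul (x y : LL) (t : ℝ) : (x * y) t = x t * y t := by
  rw [lp.infty_coeFn_mul]; rfl

lemma LL_add (x y : LL) (t : ℝ) : (x + y) t = x t + y t := rfl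
lemma LL_sub (x y : LL) (t : ℝ) : (x - y) t = x t - y t := rfl
lemma LL_smul (c : ℂ) (y : LL) (t : ℝ) : (c • y) t = c * y t := rfl
lemma LL_star (x : LL) (t : ℝ) : (star x) t = star (x t) := rfl

noncomputable def om (W : ℝ → ℝ≥0∞) (t : ℝ) : ℝ := ((W t)⁻¹).toReal

lemma om_nonneg (W : ℝ → ℝ≥0∞) (t : ℝ) : 0 ≤ om W t := ENNReal.toReal_nonneg

lemma om_le_one {W : ℝ → ℝ≥0∞} (hW : IsWeight W) (t : ℝ) : om W t ≤ 1 := by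
  have := ENNReal.inv_le_one.2 (hW.2.1 t)
  simpa [om] using ENNReal.toReal_mono ENNReal.one_ne_top this

lemma ofReal_div_W {W : ℝ → ℝ≥0∞} (hW : IsWeight W) (t a : ℝ) (ha : 0 ≤ a) :
    ENNReal.ofReal a / W t = ENNReal.ofReal (a * om W t) := by
  have h : (W t)⁻¹ ≠ ⊤ := by
    have := ENNReal.inv_le_one.2 (hW.2.1 t)
    exact ne_top_of_le_ne_top ENNReal.one_ne_top this
  rw [ENNReal.ofReal_mul ha, om, ENNReal.ofReal_toReal h, div_eq_mul_inv]

lemma small_at_infty {W : ℝ → ℝ≥0∞} (hW : IsWeight W) {f : ℝ → ℝ} (hf : ∀ t, 0 ≤ f t)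
    (h : Tendsto (fun x : ℝ => ENNReal.ofReal (f x) / W x)
      (comap (fun x : ℝ => |x|) atTop) (nhds 0)) {ε : ℝ} (hε : 0 < ε) :
    ∃ R : ℝ, 0 < R ∧ ∀ t, R ≤ |t| → f t * om W t ≤ ε := by
  have h1 := h.eventually_le_const (u := ENNReal.ofReal ε) (by simpa using hε)
  rw [Filter.eventually_comap] at h1
  obtain ⟨R, hR⟩ := Filter.eventually_atTop.1 h1
  refine ⟨max R 1, by positivity, fun t ht => ?_⟩
  have h2 := hR |t| ((le_max_left _ _).trans ht) t rfl
  rw [ofReal_div_W hW t _ (hf t)] at h2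
  exact (ENNReal.ofReal_le_ofReal_iff hε.le).1 h2

lemma mono_bdd {W : ℝ → ℝ≥0∞} (hW : IsWeight W) (n : ℕ) :
    ∃ C : ℝ, ∀ t, |t| ^ n * om W t ≤ C := by
  obtain ⟨R, hR0, hR⟩ := small_at_infty hW (fun t => by positivity) (hW.2.2.1 n) one_pos
  refine ⟨1 + R ^ n, fun t => ?_⟩
  rcases le_total R |t| with h | h
  · have := hR t h
    have : 0 ≤ R ^ n := by positivity
    linarith
  · have h1 : |t| ^ n ≤ R ^ n := by gcongr
    have h2 := om_le_one hW t
    have h3 := om_nonneg W t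
    have h4 : 0 ≤ |t| ^ n := by positivity
    nlinarith

lemma poly_bdd {W : ℝ → ℝ≥0∞} (hW : IsWeight W) (P : Polynomial ℂ) :
    ∃ C : ℝ, ∀ t : ℝ, ‖P.eval (t : ℂ) * om W t‖ ≤ C := by
  induction P using Polynomial.induction_on' with
  | add p q hp hq =>
    obtain ⟨C, hC⟩ := hp
    obtain ⟨D, hD⟩ := hq
    refine ⟨C + D, fun t => ?_⟩
    rw [Polynomial.eval_add, add_mul]
    exact (norm_add_le _ _).trans (add_le_add (hC t) (hD t))
  | monomial n a =>
    obtain ⟨C, hC⟩ := mono_bdd hW n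
    refine ⟨‖a‖ * C, fun t => ?_⟩
    rw [Polynomial.eval_monomial]
    simp only [norm_mul, norm_pow, Complex.norm_real, Real.norm_eq_abs, abs_of_nonneg (om_nonneg W t)]
    rw [mul_assoc]
    gcongr
    exact hC t

noncomputable def TT {W : ℝ → ℝ≥0∞} (hW : IsWeight W) : Polynomial ℂ →ₗ[ℂ] LL where
  toFun P := mkL (fun t => P.eval (t : ℂ) * om W t) (poly_bdd hW P)
  map_add' p q := by
    ext t; simp [add_mul]
  map_smul' c p := by
    ext t; simp [mul_assoc]

lemma TT_apply {W : ℝ → ℝ≥0∞} (hW : IsWeight W) (P : Polynomial ℂ) (t : ℝ) :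
    TT hW P t = P.eval (t : ℂ) * om W t := rfl

lemma sub_norm_ge (z : ℂ) (t : ℝ) : |z.im| ≤ ‖(t : ℂ) - z‖ := by
  have := Complex.abs_im_le_norm ((t : ℂ) - z)
  simpa using this

lemma bb_bdd (z : ℂ) (hz : z.im ≠ 0) (t : ℝ) : ‖((t : ℂ) - z)⁻¹‖ ≤ |z.im|⁻¹ := by
  rw [norm_inv]
  have := sub_norm_ge z t
  have : 0 < |z.im| := by positivity
  gcongr

noncomputable def bb (z : ℂ) : LL :=
  mkL (fun t => if z.im = 0 then 0 else ((t : ℂ) - z)⁻¹) ⟨|z.im|⁻¹, fun t => by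
    split_ifs with h
    · simp
    · exact bb_bdd z h t⟩

lemma bb_apply {z : ℂ} (hz : z.im ≠ 0) (t : ℝ) : bb z t = ((t : ℂ) - z)⁻¹ := by
  simp [bb, hz]

lemma bb_norm {z : ℂ} (hz : z.im ≠ 0) : ‖bb z‖ ≤ |z.im|⁻¹ :=
  LL_norm_le (by positivity) (fun t => by rw [bb_apply hz]; exact bb_bdd z hz t)

lemma sub_ne {z : ℂ} (hz : z.im ≠ 0) (t : ℝ) : (t : ℂ) - z ≠ 0 := by
  intro h
  have := sub_norm_ge z t
  rw [h, norm_zero] at this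
  exact hz (abs_eq_zero.1 (le_antisymm this (abs_nonneg _)))

lemma bb_sub {z w : ℂ} (hz : z.im ≠ 0) (hw : w.im ≠ 0) :
    bb z - bb w = (z - w) • (bb z * bb w) := by
  ext t
  rw [LL_sub, LL_smul, LL_mul, bb_apply hz, bb_apply hw]
  have := sub_ne hz t
  have := sub_ne hw t
  field_simp
  ring

/-- the resolvent acts on polynomials -/
lemma bb_TT {W : ℝ → ℝ≥0∞} (hW : IsWeight W) {z : ℂ} (hz : z.im ≠ 0) (P : Polynomial ℂ) :
    ∃ Q : Polynomial ℂ, bb z * TT hW P = TT hW Q + P.eval z • (bb z * TT hW 1) := by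
  obtain ⟨Q, hQ⟩ := Polynomial.X_sub_C_dvd_sub_C_eval (p := P) (a := z)
  refine ⟨Q, ?_⟩
  ext t
  rw [LL_add, LL_smul, LL_mul, LL_mul, bb_apply hz, TT_apply, TT_apply, TT_apply]
  have h1 := congrArg (Polynomial.eval (t : ℂ)) hQ
  simp only [Polynomial.eval_sub, Polynomial.eval_C, Polynomial.eval_mul, Polynomial.eval_X] at h1
  have h2 : P.eval (t : ℂ) = P.eval z + (t - z) * Q.eval (t : ℂ) := by linear_combination h1
  have := sub_ne hz t
  rw [h2, Polynomial.eval_one]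
  field_simp
  ring

noncomputable def VV {W : ℝ → ℝ≥0∞} (hW : IsWeight W) : Submodule ℂ LL :=
  (LinearMap.range (TT hW)).topologicalClosure

lemma TT_mem {W : ℝ → ℝ≥0∞} (hW : IsWeight W) (P : Polynomial ℂ) : TT hW P ∈ VV hW :=
  Submodule.le_topologicalClosure _ ⟨P, rfl⟩

lemma VV_map {W : ℝ → ℝ≥0∞} (hW : IsWeight W) {g : LL → LL} (hg : Continuous g)
    (h : ∀ P, g (TT hW P) ∈ VV hW) {v : LL} (hv : v ∈ VV hW) : g v ∈ VV hW := by
  have hc : IsClosed (VV hW : Set LL) := Submodule.isClosed_topologicalClosure _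
  have : IsClosed {v | g v ∈ VV hW} := hc.preimage hg
  have h2 : closure (LinearMap.range (TT hW) : Set LL) ⊆ {v | g v ∈ VV hW} := by
    apply closure_minimal _ this
    rintro _ ⟨P, rfl⟩
    exact h P
  exact h2 hv

lemma VV_star {W : ℝ → ℝ≥0∞} (hW : IsWeight W) {v : LL} (hv : v ∈ VV hW) : star v ∈ VV hW := by
  refine VV_map hW continuous_star (fun P => ?_) hv
  have : star (TT hW P) = TT hW (P.map (starRingEnd ℂ)) := by
    ext t
    rw [LL_star, TT_apply, TT_apply]
    have h : (P.map (starRingEnd ℂ)).eval (t : ℂ) = starRingEnd ℂ (P.eval (t : ℂ)) := by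
      conv_lhs => rw [← Complex.conj_ofReal t]
      rw [Polynomial.eval_map_apply]
    rw [h]
    simp
  rw [this]
  exact TT_mem hW _

lemma VV_bb {W : ℝ → ℝ≥0∞} (hW : IsWeight W) {z : ℂ} (hz : z.im ≠ 0)
    (h : bb z * TT hW 1 ∈ VV hW) {v : LL} (hv : v ∈ VV hW) : bb z * v ∈ VV hW := by
  refine VV_map hW (continuous_const.mul continuous_id) (fun P => ?_) hv
  obtain ⟨Q, hQ⟩ := bb_TT hW hz P
  change bb z * TT hW P ∈ VV hW
  rw [hQ]
  exact (VV hW).add_mem (TT_mem hW Q) ((VV hW).smul_mem _ h)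

noncomputable def rho (f : C(OnePoint ℝ, ℂ)) : LL :=
  mkL (fun t => f (t : OnePoint ℝ)) ⟨‖f‖, fun _ => f.norm_coe_le_norm _⟩

lemma rho_apply (f : C(OnePoint ℝ, ℂ)) (t : ℝ) : rho f t = f (t : OnePoint ℝ) := rfl

lemma rho_cont : Continuous rho := by
  have : LipschitzWith 1 rho := by
    apply LipschitzWith.of_dist_le_mul
    intro f g
    rw [NNReal.coe_one, one_mul, dist_eq_norm, dist_eq_norm]
    refine LL_norm_le (norm_nonneg _) (fun t => ?_)
    exact (f - g).norm_coe_le_norm (t : OnePoint ℝ)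
  exact this.continuous

noncomputable def ext1 (f : ℝ → ℂ) : OnePoint ℝ → ℂ := fun x => @OnePoint.rec ℝ (fun _ => ℂ) 0 f x

noncomputable def extC (f : ℝ → ℂ) (hf : Continuous f) (h : Tendsto f (cocompact ℝ) (nhds 0)) :
    C(OnePoint ℝ, ℂ) where
  toFun := ext1 f
  continuous_toFun := by
    rw [OnePoint.continuous_iff]
    constructor
    · rw [coclosedCompact_eq_cocompact]
      exact h
    · exact hf

lemma extC_apply (f : ℝ → ℂ) (hf h) (t : ℝ) : extC f hf h (t : OnePoint ℝ) = f t := rfl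
lemma extC_infty (f : ℝ → ℂ) (hf h) : extC f hf h OnePoint.infty = 0 := rfl

noncomputable def cC (z : ℂ) (hz : z.im ≠ 0) : C(OnePoint ℝ, ℂ) :=
  extC (fun t => ((t : ℂ) - z)⁻¹)
    ((Complex.continuous_ofReal.sub continuous_const).inv₀ (sub_ne hz))
    (by
      refine tendsto_inv₀_cobounded.comp ?_
      have h1 : Tendsto (fun t : ℝ => (t : ℂ)) (cocompact ℝ) (Bornology.cobounded ℂ) := by
        rw [← Metric.cobounded_eq_cocompact, ← tendsto_norm_atTop_iff_cobounded]
        simp only [Complex.norm_real]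
        exact tendsto_norm_cobounded_atTop (E := ℝ)
      rw [← tendsto_norm_atTop_iff_cobounded] at h1 ⊢
      refine tendsto_atTop_mono (f := fun t : ℝ => ‖(t:ℂ)‖ - ‖z‖) (fun t => norm_sub_norm_le _ _) ?_
      exact tendsto_atTop_add_const_right _ _ h1)

lemma rho_cC (z : ℂ) (hz : z.im ≠ 0) : rho (cC z hz) = bb z := by
  ext t; rw [bb_apply hz]; rfl

lemma VV_all {W : ℝ → ℝ≥0∞} (hW : IsWeight W) {z : ℂ} (hz : z.im ≠ 0)
    (h : bb z * TT hW 1 ∈ VV hW) (f : C(OnePoint ℝ, ℂ)) :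
    ∀ v ∈ VV hW, rho f * v ∈ VV hW := by
  let A : StarSubalgebra ℂ C(OnePoint ℝ, ℂ) := 
    { carrier := {f | ∀ v ∈ VV hW, rho f * v ∈ VV hW}
      mul_mem' := by
        intro a b ha hb v hv
        have : rho (a * b) * v = rho a * (rho b * v) := by
          ext t; simp only [LL_mul, rho_apply, ContinuousMap.mul_apply]; ring
        rw [this]
        exact ha _ (hb v hv)
      add_mem' := by
        intro a b ha hb v hv
        have : rho (a + b) * v = rho a * v + rho b * v := by
          ext t; simp only [LL_mul, LL_add, rho_apply, ContinuousMap.add_apply]; ring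
        rw [this]
        exact (VV hW).add_mem (ha v hv) (hb v hv)
      algebraMap_mem' := by
        intro c v hv
        have : rho (algebraMap ℂ _ c) * v = c • v := by
          ext t; simp only [LL_mul, LL_smul, rho_apply]; simp
        rw [this]
        exact (VV hW).smul_mem _ hv
      star_mem' := by
        intro a ha v hv
        have : rho (star a) * v = star (rho a * star v) := by
          ext t; simp only [LL_mul, LL_star, rho_apply, ContinuousMap.star_apply]; simp
        rw [this]
        exact VV_star hW (ha _ (VV_star hW hv)) }
  have hc : IsClosed (A : Set C(OnePoint ℝ, ℂ)) := by
    have : (A : Set C(OnePoint ℝ, ℂ)) = ⋂ v ∈ VV hW, {f | rho f * v ∈ VV hW} := by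
      ext f; simp [A]
    rw [this]
    refine isClosed_biInter fun v _ => ?_
    have h0 : IsClosed (VV hW : Set LL) := Submodule.isClosed_topologicalClosure _
    exact h0.preimage (rho_cont.mul continuous_const)
  have hcA : cC z hz ∈ A := fun v hv => by
    rw [rho_cC]; exact VV_bb hW hz h hv
  have hsep : A.SeparatesPoints := by
    intro x y hxy
    refine ⟨_, ⟨cC z hz, hcA, rfl⟩, ?_⟩
    induction x using OnePoint.rec with
    | infty =>
      induction y using OnePoint.rec with
      | infty => exact absurd rfl hxy
      | coe y => exact (inv_ne_zero (sub_ne hz y)).symm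
    | coe x =>
      induction y using OnePoint.rec with
      | infty => exact (inv_ne_zero (sub_ne hz x))
      | coe y =>
        intro he
        have : ((x:ℂ) - z)⁻¹ = ((y:ℂ) - z)⁻¹ := he
        have := sub_left_injective (inv_injective this)
        exact hxy (by rw [Complex.ofReal_injective this])
  have htop := ContinuousMap.starSubalgebra_topologicalClosure_eq_top_of_separatesPoints A hsep
  have : f ∈ A.topologicalClosure := by rw [htop]; trivial
  have h3 : (A.topologicalClosure : Set C(OnePoint ℝ, ℂ)) = A := by
    rw [StarSubalgebra.topologicalClosure_coe, hc.closure_eq]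
  have h4 : f ∈ (A : Set C(OnePoint ℝ, ℂ)) := by rw [← h3]; exact this
  exact h4

lemma dense_of_mem {W : ℝ → ℝ≥0∞} (hW : IsWeight W) {z : ℂ} (hz : z.im ≠ 0)
    (h : bb z * TT hW 1 ∈ VV hW) : PolyDense W := by
  intro f hf ε hε
  obtain ⟨R, hR0, hR⟩ := small_at_infty hW (fun t => norm_nonneg (f t)) hf.2
    (show 0 < ε / 4 by positivity)
  let χ : ℝ → ℝ := fun t => max 0 (min 1 (R + 1 - |t|))
  have hχc : Continuous χ := by fun_prop
  have hχ0 : ∀ t, 0 ≤ χ t := fun t => le_max_left _ _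
  have hχ1 : ∀ t, χ t ≤ 1 := fun t => max_le zero_le_one (min_le_left _ _)
  have hχR : ∀ t, |t| ≤ R → χ t = 1 := fun t ht => by
    simp only [χ]; rw [min_eq_left (by linarith)]; simp
  have hχz : ∀ t, R + 1 ≤ |t| → χ t = 0 := fun t ht => by
    simp only [χ]; exact max_eq_left ((min_le_right _ _).trans (by linarith))
  let g : ℝ → ℂ := fun t => (χ t : ℂ) * f t
  have hgc : Continuous g := (Complex.continuous_ofReal.comp hχc).mul hf.1
  have hg0 : Tendsto g (cocompact ℝ) (nhds 0) := by
    refine tendsto_const_nhds.congr' ?_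
    rw [← Metric.cobounded_eq_cocompact]
    filter_upwards [(tendsto_norm_cobounded_atTop (E := ℝ)).eventually_ge_atTop (R + 1)] with t ht
    simp only [g, hχz t ht]; simp
  have hm := VV_all hW hz h (extC g hgc hg0) _ (TT_mem hW 1)
  obtain ⟨_, ⟨P, rfl⟩, hP⟩ := Metric.mem_closure_iff.1 hm (ε / 4) (by positivity)
  refine ⟨P, ?_⟩
  refine lt_of_le_of_lt (b := ENNReal.ofReal (ε / 2)) ?_
    ((ENNReal.ofReal_lt_ofReal_iff hε).2 (by linarith))
  refine iSup_le fun t => ?_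
  rw [ofReal_div_W hW _ _ (norm_nonneg _)]
  apply ENNReal.ofReal_le_ofReal
  have ho := om_nonneg W t
  have h1 : ‖g t - P.eval (t : ℂ)‖ * om W t ≤ ε / 4 := by
    rw [dist_eq_norm] at hP
    have := (LL_apply_le _ t).trans hP.le
    rw [LL_sub, LL_mul, TT_apply, TT_apply, rho_apply, extC_apply, Polynomial.eval_one, one_mul,
      ← sub_mul, norm_mul, Complex.norm_real, Real.norm_of_nonneg ho] at this
    exact this
  have h2 : ‖f t - g t‖ * om W t ≤ ε / 4 := by
    have h3 : f t - g t = ((1 - χ t : ℝ) : ℂ) * f t := by simp only [g]; push_cast; ring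
    rw [h3, norm_mul, Complex.norm_real, Real.norm_of_nonneg (by linarith [hχ1 t])]
    rcases le_total R |t| with hc | hc
    · have h4 := hR t hc
      have h5 : 0 ≤ ‖f t‖ * om W t := by positivity
      nlinarith [hχ0 t, hχ1 t]
    · rw [hχR t hc]; simp; positivity
  have h6 : ‖f t - P.eval (t : ℂ)‖ ≤ ‖f t - g t‖ + ‖g t - P.eval (t : ℂ)‖ := norm_sub_le_norm_sub_add_norm_sub _ _ _
  nlinarith

/-- the Cauchy transform of an annihilating functional -/
lemma exists_F {W : ℝ → ℝ≥0∞} (hW : IsWeight W) (hnd : ¬ PolyDense W) :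
    ∃ (F : ℂ → ℂ) (K : ℝ), 1 ≤ K ∧ DifferentiableOn ℂ F {z | 0 < z.im} ∧
      (∀ z, 1 ≤ z.im → ‖F z‖ ≤ K) ∧ F (2 * I) ≠ 0 ∧
      ∀ P ∈ XW W, ∀ z : ℂ, 1 ≤ z.im → ‖P.eval z‖ * ‖F z‖ ≤ K := by
  have hz : (2 * I : ℂ).im ≠ 0 := by simp
  have hn : bb (2 * I) * TT hW 1 ∉ VV hW := fun h => hnd (dense_of_mem hW hz h)
  obtain ⟨Λ, hΛ0, hΛ1⟩ : ∃ Λ : LL →L[ℂ] ℂ, (∀ v ∈ VV hW, Λ v = 0) ∧ Λ (bb (2 * I) * TT hW 1) ≠ 0 := by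
    have hc : IsClosed (VV hW : Set LL) := Submodule.isClosed_topologicalClosure _
    have hne : ‖(VV hW).mkQ (bb (2 * I) * TT hW 1)‖ ≠ 0 := by
      intro h0
      have := (QuotientAddGroup.norm_mk_eq_zero_iff_mem_closure (S := (VV hW).toAddSubgroup)).1 h0
      rw [show ((VV hW).toAddSubgroup : Set LL) = VV hW from rfl, hc.closure_eq] at this
      exact hn this
    obtain ⟨g, -, hg⟩ := exists_dual_vector ℂ _ hne
    refine ⟨g.comp (VV hW).mkQL, fun v hv => ?_, ?_⟩
    · have : (VV hW).mkQ v = 0 := by simpa using hv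
      show g ((VV hW).mkQ v) = 0
      rw [this, map_zero]
    · show g ((VV hW).mkQ _) ≠ 0
      rw [hg]; exact Complex.ofReal_ne_zero.2 hne
  have hone : ∀ P ∈ XW W, ‖TT hW P‖ ≤ 1 := by
    intro P hP
    refine LL_norm_le zero_le_one fun t => ?_
    rw [TT_apply, norm_mul, Complex.norm_real, Real.norm_of_nonneg (om_nonneg W t)]
    have h1 : ENNReal.ofReal ‖P.eval (t:ℂ)‖ / W t ≤ 1 :=
      (ENNReal.div_le_div_right (hP t) _).trans ENNReal.div_self_le_one
    rw [ofReal_div_W hW _ _ (norm_nonneg _)] at h1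
    exact ENNReal.ofReal_le_one.1 h1
  have h1X : (1 : Polynomial ℂ) ∈ XW W := by
    intro t; simpa using hW.2.1 t
  have hmain : ∀ P ∈ XW W, ∀ z : ℂ, 1 ≤ z.im → ‖P.eval z‖ * ‖Λ (bb z * TT hW 1)‖ ≤ max ‖Λ‖ 1 := by
    intro P hP z hzi
    have hz0 : z.im ≠ 0 := by positivity
    obtain ⟨Q, hQ⟩ := bb_TT hW hz0 P
    have h2 : Λ (bb z * TT hW P) = P.eval z * Λ (bb z * TT hW 1) := by
      rw [hQ, map_add, hΛ0 _ (TT_mem hW Q), zero_add, map_smul, smul_eq_mul]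
    rw [← norm_mul, ← h2]
    have h3 : ‖bb z‖ ≤ 1 := by
      refine (bb_norm hz0).trans (inv_le_one_of_one_le₀ ?_)
      exact hzi.trans (le_abs_self _)
    calc _ ≤ ‖Λ‖ * ‖bb z * TT hW P‖ := Λ.le_opNorm _
      _ ≤ ‖Λ‖ * (1 * 1) := by
        gcongr
        exact (norm_mul_le _ _).trans (mul_le_mul h3 (hone P hP) (norm_nonneg _) zero_le_one)
      _ ≤ _ := by simp
  refine ⟨fun z => Λ (bb z * TT hW 1), max ‖Λ‖ 1, le_max_right _ _, ?_, ?_, hΛ1, hmain⟩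
  · have hop : IsOpen {z : ℂ | 0 < z.im} := isOpen_lt continuous_const Complex.continuous_im
    have hcont : ContinuousOn bb {z : ℂ | 0 < z.im} := by
      intro z hz
      have hz' : 0 < z.im := hz
      rw [ContinuousWithinAt, tendsto_iff_norm_sub_tendsto_zero]
      have hb : ∀ᶠ w in nhdsWithin z {z : ℂ | 0 < z.im}, ‖bb w - bb z‖ ≤ ‖w - z‖ * ((z.im / 2)⁻¹ * |z.im|⁻¹) := by
        have h5 : ∀ᶠ w : ℂ in nhdsWithin z {z : ℂ | 0 < z.im}, z.im / 2 < w.im :=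
          (Complex.continuous_im.continuousAt.eventually_const_lt (by linarith)).filter_mono nhdsWithin_le_nhds
        filter_upwards [h5] with w hw
        have hw0 : 0 < w.im := by linarith
        rw [bb_sub hw0.ne' hz'.ne', norm_smul]
        gcongr
        refine (norm_mul_le _ _).trans ?_
        have h6 := bb_norm hw0.ne'
        have h7 : |w.im|⁻¹ ≤ (z.im / 2)⁻¹ := by
          rw [abs_of_pos hw0]; gcongr
        exact mul_le_mul (h6.trans h7) (bb_norm hz'.ne') (norm_nonneg _) (by positivity)
      refine squeeze_zero' (Eventually.of_forall fun _ => norm_nonneg _) hb ?_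
      have : Tendsto (fun w => ‖w - z‖ * ((z.im / 2)⁻¹ * |z.im|⁻¹)) (nhds z) (nhds (‖z - z‖ * ((z.im / 2)⁻¹ * |z.im|⁻¹))) := by
        apply Continuous.tendsto; fun_prop
      simpa using this.mono_left nhdsWithin_le_nhds
    intro z hz
    have hz' : 0 < z.im := hz
    have hd : HasDerivAt (fun z => Λ (bb z * TT hW 1)) (Λ (bb z * bb z * TT hW 1)) z := by
      rw [hasDerivAt_iff_tendsto_slope]
      have hcz : ContinuousAt bb z := hcont.continuousAt (hop.mem_nhds hz)
      have : Tendsto (fun w => Λ (bb w * bb z * TT hW 1)) (nhdsWithin z {z}ᶜ) (nhds (Λ (bb z * bb z * TT hW 1))) := by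
        have : ContinuousAt (fun w => Λ (bb w * bb z * TT hW 1)) z :=
          Λ.continuous.continuousAt.comp ((hcz.mul continuousAt_const).mul continuousAt_const)
        exact this.tendsto.mono_left nhdsWithin_le_nhds
      refine this.congr' ?_
      filter_upwards [nhdsWithin_le_nhds (hop.mem_nhds hz), self_mem_nhdsWithin] with w hw hwz
      have hw' : 0 < w.im := hw
      have hne : w - z ≠ 0 := sub_ne_zero.2 hwz
      rw [slope_def_field, ← map_sub, ← sub_mul, bb_sub hw'.ne' hz'.ne', smul_mul_assoc, map_smul, smul_eq_mul]
      field_simp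
    exact hd.differentiableAt.differentiableWithinAt
  · intro z hzi
    have := hmain 1 h1X z hzi
    simpa using this

noncomputable def rfl1 (r : ℂ) : ℂ := if 0 ≤ r.im then r else starRingEnd ℂ r

lemma rfl1_im (r : ℂ) : 0 ≤ (rfl1 r).im := by
  unfold rfl1; split_ifs with h
  · exact h
  · simp at h ⊢; exact h.le

lemma rfl1_norm (r : ℂ) (x : ℝ) : ‖(x : ℂ) - rfl1 r‖ = ‖(x : ℂ) - r‖ := by
  unfold rfl1; split_ifs with h
  · rfl
  · rw [← Complex.norm_conj ((x:ℂ) - r)]; simp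

lemma down_norm {w : ℂ} (hw : 0 ≤ w.im) (x : ℝ) {h : ℝ} (hh : 1 ≤ h) :
    ‖(x : ℂ) - w‖ ≤ ‖(x : ℂ) + I - I * h - w‖ := by
  rw [← sq_le_sq₀ (norm_nonneg _) (norm_nonneg _), ← Complex.normSq_eq_norm_sq, ← Complex.normSq_eq_norm_sq,
    Complex.normSq_apply, Complex.normSq_apply]
  simp
  nlinarith [mul_nonneg hw (sub_nonneg.2 hh)]

lemma reflect (P : Polynomial ℂ) : ∃ Q : Polynomial ℂ,
    (∀ x : ℝ, ‖Q.eval (x : ℂ)‖ = ‖P.eval (x : ℂ)‖) ∧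
    ∀ (x h : ℝ), 1 ≤ h → ‖Q.eval (x : ℂ)‖ ≤ ‖Q.eval ((x : ℂ) + I - I * h)‖ := by
  have key : ∀ s : Multiset ℂ, ∃ Q : Polynomial ℂ,
    (∀ x : ℝ, ‖Q.eval (x : ℂ)‖ = ‖((s.map (fun r => Polynomial.X - Polynomial.C r)).prod).eval (x : ℂ)‖) ∧
    ∀ (x h : ℝ), 1 ≤ h → ‖Q.eval (x : ℂ)‖ ≤ ‖Q.eval ((x : ℂ) + I - I * h)‖ := by
    intro s
    induction s using Multiset.induction with
    | empty => exact ⟨1, by simp, by simp⟩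
    | cons r s ih =>
      obtain ⟨Q, h1, h2⟩ := ih
      refine ⟨(Polynomial.X - Polynomial.C (rfl1 r)) * Q, fun x => ?_, fun x h hh => ?_⟩
      · rw [Multiset.map_cons, Multiset.prod_cons, Polynomial.eval_mul, Polynomial.eval_mul, norm_mul, norm_mul, h1]
        simp [rfl1_norm]
      · rw [Polynomial.eval_mul, Polynomial.eval_mul, norm_mul, norm_mul]
        refine mul_le_mul ?_ (h2 x h hh) (norm_nonneg _) (norm_nonneg _)
        simpa using down_norm (rfl1_im r) x hh
  obtain ⟨Q, h1, h2⟩ := key P.roots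
  refine ⟨Polynomial.C P.leadingCoeff * Q, fun x => ?_, fun x h hh => ?_⟩
  · have := (IsAlgClosed.splits P).eq_prod_roots
    conv_rhs => rw [this]
    rw [Polynomial.eval_mul, Polynomial.eval_mul, norm_mul, norm_mul, h1]
  · rw [Polynomial.eval_mul, Polynomial.eval_mul, norm_mul, norm_mul]
    simp only [Polynomial.eval_C]
    exact mul_le_mul_of_nonneg_left (h2 x h hh) (norm_nonneg _)

lemma MW_bound {W : ℝ → ℝ≥0∞} {F : ℂ → ℂ} {K : ℝ} (hK : 1 ≤ K)
    (hF : ∀ P ∈ XW W, ∀ z : ℂ, 1 ≤ z.im → ‖P.eval z‖ * ‖F z‖ ≤ K) (x h : ℝ) (hh : 1 ≤ h) :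
    elog (MW W x) ≤ ∫⁻ t : ℝ, ENNReal.ofReal (h / (h ^ 2 + (t - x) ^ 2)) * nlog K (F (t + I)) := by
  set B := ∫⁻ t : ℝ, ENNReal.ofReal (h / (h ^ 2 + (t - x) ^ 2)) * nlog K (F (t + I)) with hB
  by_cases hBt : B = ⊤
  · rw [hBt]; exact le_top
  have h1 : ∀ P ∈ XW W, ENNReal.ofReal (Real.log ‖P.eval (x : ℂ)‖) ≤ B := by
    intro P hP
    obtain ⟨Q, hQ1, hQ2⟩ := reflect P
    have hQX : Q ∈ XW W := fun t => by rw [hQ1]; exact hP t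
    rw [← hQ1]
    by_cases h0 : ‖Q.eval (x : ℂ)‖ = 0
    · rw [h0]; simp
    have h0' : 0 < ‖Q.eval (x : ℂ)‖ := lt_of_le_of_ne (norm_nonneg _) (Ne.symm h0)
    refine (ENNReal.ofReal_le_ofReal (Real.log_le_log h0' (hQ2 x h hh))).trans ?_
    refine (poly_poisson Q x h (by linarith)).trans ?_
    refine lintegral_mono fun t => ?_
    gcongr
    have hm := hF Q hQX ((t : ℂ) + I) (by simp)
    unfold nlog
    split_ifs with hz
    · exact le_top
    · have hz' : 0 < ‖F (t + I)‖ := norm_pos_iff.2 hz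
      rcases eq_or_ne (‖Q.eval ((t : ℂ) + I)‖) 0 with hq | hq
      · rw [hq]; simp
      apply ENNReal.ofReal_le_ofReal
      have h3 := Real.log_le_log (by positivity) hm
      rw [Real.log_mul hq hz'.ne'] at h3
      linarith
  have h2 : MW W x ≤ ENNReal.ofReal (Real.exp B.toReal) := by
    refine iSup₂_le fun P hP => ?_
    apply ENNReal.ofReal_le_ofReal
    rcases eq_or_ne (‖P.eval (x : ℂ)‖) 0 with hq | hq
    · rw [hq]; positivity
    · rw [← Real.log_le_iff_le_exp (by positivity)]
      exact (ENNReal.ofReal_le_iff_le_toReal hBt).1 (h1 P hP)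
  have h3 : MW W x ≠ ⊤ := ne_top_of_le_ne_top ENNReal.ofReal_ne_top h2
  rw [elog, if_neg h3]
  rw [ENNReal.ofReal_le_iff_le_toReal hBt]
  rcases eq_or_ne (MW W x).toReal 0 with hq | hq
  · rw [hq]; simp
  · rw [Real.log_le_iff_le_exp (lt_of_le_of_ne ENNReal.toReal_nonneg hq.symm)]
    have := ENNReal.toReal_mono ENNReal.ofReal_ne_top h2
    rwa [ENNReal.toReal_ofReal (by positivity)] at this

noncomputable def NN (n : ℤ) : ℝ := max |(n : ℝ)| 1

lemma NN_one (n : ℤ) : 1 ≤ NN n := le_max_right _ _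

noncomputable def lam (p : ℝ) (n : ℤ) : ℝ := |(n : ℝ)| ^ p * Real.sign n

lemma abs_lam {p : ℝ} (hp : 1 < p) (n : ℤ) : |lam p n| = |(n : ℝ)| ^ p := by
  unfold lam
  rcases lt_trichotomy (n : ℝ) 0 with h | h | h
  · rw [Real.sign_of_neg h]
    rw [mul_neg_one, abs_neg, abs_of_nonneg (by positivity)]
  · rw [h]; simp [Real.zero_rpow (by linarith : p ≠ 0)]
  · rw [Real.sign_of_pos h]
    rw [mul_one, abs_of_nonneg (by positivity)]

lemma rpow_split {p a : ℝ} (hp : 1 < p) (ha : 0 ≤ a) : a ^ p = a * a ^ (p - 1) := by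
  rw [← Real.rpow_one_add' ha (by linarith)]; congr 1; ring

lemma rpow_diff {p a b M : ℝ} (hp : 1 < p) (ha : 0 ≤ a) (hb : 0 ≤ b) (hM : 0 ≤ M) (hM2 : M ≤ max a b) :
    |a - b| * M ^ (p - 1) ≤ |a ^ p - b ^ p| := by
  wlog hab : b ≤ a generalizing a b
  · rw [abs_sub_comm a b, abs_sub_comm (a ^ p)]
    exact this hb ha (by rwa [max_comm]) (le_of_not_ge hab)
  have h1 : M ^ (p - 1) ≤ a ^ (p - 1) := by
    rw [max_eq_left hab] at hM2
    exact Real.rpow_le_rpow hM hM2 (by linarith)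
  have h2 : b ^ (p - 1) ≤ a ^ (p - 1) := Real.rpow_le_rpow hb hab (by linarith)
  have h3 : b ^ p ≤ a ^ p := Real.rpow_le_rpow hb hab (by linarith)
  rw [abs_of_nonneg (sub_nonneg.2 hab), abs_of_nonneg (sub_nonneg.2 h3), rpow_split hp ha, rpow_split hp hb]
  nlinarith [mul_le_mul_of_nonneg_left h1 (sub_nonneg.2 hab), mul_le_mul_of_nonneg_left h2 hb]

noncomputable def kk (p : ℝ) (n : ℤ) (t : ℝ) : ℝ :=
  1 / (NN n ^ 2 * ((NN n ^ (p - 1)) ^ 2 + (lam p n - t) ^ 2))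

lemma kk_bound {p : ℝ} (hp : 1 < p) (n : ℤ) (t : ℝ) :
    (1 + t ^ 2) * kk p n t ≤ (8 + 2 * (2 ^ p) ^ 2) *
      (1 / NN n ^ 2 + 1 / (1 + (|(n : ℝ)| - |t| ^ (1 / p)) ^ 2)) := by
  set m := |(n : ℝ)| with hm
  set τ := |t| ^ (1 / p) with hτ
  set N := NN n with hN
  have hN1 : 1 ≤ N := NN_one n
  have hm0 : 0 ≤ m := abs_nonneg _
  have hτ0 : 0 ≤ τ := by positivity
  have htp : τ ^ p = |t| := by
    rw [hτ, ← Real.rpow_mul (abs_nonneg t), one_div_mul_cancel (by linarith), Real.rpow_one]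
  have ht2 : t ^ 2 = (τ ^ p) ^ 2 := by rw [htp, sq_abs]
  set A := N ^ (p - 1) with hA
  have hA1 : 1 ≤ A := Real.one_le_rpow hN1 (by linarith)
  set c : ℝ := (2 : ℝ) ^ p with hc
  have hdiff : |m ^ p - τ ^ p| ≤ |lam p n - t| := by
    rw [htp, hm, ← abs_lam hp n]; exact abs_abs_sub_abs_le _ _
  have hden : 0 < N ^ 2 * (A ^ 2 + (lam p n - t) ^ 2) := by positivity
  have hs : 0 < 1 + (m - τ) ^ 2 := by positivity
  have hk : kk p n t = 1 / (N ^ 2 * (A ^ 2 + (lam p n - t) ^ 2)) := rfl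
  rw [hk, mul_one_div]
  have side1 : (1 + t ^ 2) ≤ 8 * (A ^ 2 + (lam p n - t) ^ 2) →
      (1 + t ^ 2) / (N ^ 2 * (A ^ 2 + (lam p n - t) ^ 2)) ≤ (8 + 2 * c ^ 2) * (1 / N ^ 2 + 1 / (1 + (m - τ) ^ 2)) := by
    intro h
    have h1 : (1 + t ^ 2) / (N ^ 2 * (A ^ 2 + (lam p n - t) ^ 2)) ≤ 8 * (1 / N ^ 2) := by
      rw [div_le_iff₀ hden]
      have : 8 * (1 / N ^ 2) * (N ^ 2 * (A ^ 2 + (lam p n - t) ^ 2)) = 8 * (A ^ 2 + (lam p n - t) ^ 2) := by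
        field_simp
      rw [this]; exact h
    have h2 : 0 ≤ 1 / N ^ 2 := by positivity
    have h3 : 0 ≤ 1 / (1 + (m - τ) ^ 2) := by positivity
    nlinarith [mul_nonneg (sq_nonneg c) h2, mul_nonneg (sq_nonneg c) h3]
  rcases le_or_gt τ 1 with h1 | h1
  · apply side1
    have : τ ^ p ≤ 1 := Real.rpow_le_one hτ0 h1 (by linarith)
    have h0 : 0 ≤ τ ^ p := by positivity
    rw [ht2]
    nlinarith [sq_nonneg (lam p n - t)]
  have hT1 : 1 ≤ τ ^ p := Real.one_le_rpow h1.le (by linarith)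
  rcases le_or_gt τ (2 * N) with h2 | h2
  · have hle : N ≤ max m τ := by
      rw [hN, NN]; exact max_le_max le_rfl h1.le
    have h3 := rpow_diff hp hm0 hτ0 (by linarith : 0 ≤ N) hle
    have h4 : |m - τ| * A ≤ |lam p n - t| := h3.trans hdiff
    have h5 : (m - τ) ^ 2 * A ^ 2 ≤ (lam p n - t) ^ 2 := by
      rw [← sq_abs (m - τ), ← sq_abs (lam p n - t), ← mul_pow]
      gcongr
    have h6 : τ ^ p ≤ c * (N * A) := by
      rw [hA, ← rpow_split hp (by linarith), hc, ← Real.mul_rpow (by norm_num) (by linarith)]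
      exact Real.rpow_le_rpow hτ0 h2 (by linarith)
    have h7 : 1 + t ^ 2 ≤ 2 * c ^ 2 * (N ^ 2 * A ^ 2) := by
      have : (τ ^ p) ^ 2 ≤ (c * (N * A)) ^ 2 := by gcongr
      rw [ht2]; nlinarith
    have h8 : (1 + t ^ 2) / (N ^ 2 * (A ^ 2 + (lam p n - t) ^ 2)) ≤ 2 * c ^ 2 * (1 / (1 + (m - τ) ^ 2)) := by
      rw [div_le_iff₀ hden, mul_one_div, div_mul_eq_mul_div, le_div_iff₀ hs]
      calc (1 + t ^ 2) * (1 + (m - τ) ^ 2) ≤ (2 * c ^ 2 * (N ^ 2 * A ^ 2)) * (1 + (m - τ) ^ 2) := by gcongr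
        _ = 2 * c ^ 2 * (N ^ 2 * (A ^ 2 + (m - τ) ^ 2 * A ^ 2)) := by ring
        _ ≤ _ := by gcongr
    have h2 : 0 ≤ 1 / N ^ 2 := by positivity
    have h3 : 0 ≤ 1 / (1 + (m - τ) ^ 2) := by positivity
    nlinarith [mul_nonneg (sq_nonneg c) h2, mul_nonneg (sq_nonneg c) h3]
  · apply side1
    have hmN : m ≤ N := le_max_left _ _
    have h3 : m ^ p ≤ (τ / 2) ^ p := Real.rpow_le_rpow hm0 (by linarith) (by linarith)
    have hc2 : 2 ≤ c := by
      rw [hc]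
      calc (2:ℝ) = 2 ^ (1:ℝ) := by simp
        _ ≤ 2 ^ p := Real.rpow_le_rpow_of_exponent_le (by norm_num) hp.le
    rw [Real.div_rpow hτ0 (by norm_num)] at h3
    have h4 : τ ^ p / 2 ^ p ≤ τ ^ p / 2 := by gcongr
    have h5 : τ ^ p / 2 ≤ |lam p n - t| := by
      refine le_trans ?_ hdiff
      rw [abs_sub_comm]
      refine le_trans ?_ (le_abs_self _)
      linarith
    have h6 : (τ ^ p / 2) ^ 2 ≤ (lam p n - t) ^ 2 := by
      rw [← sq_abs (lam p n - t)]
      gcongr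
    rw [ht2]
    nlinarith [sq_nonneg A]

noncomputable def SS : ℝ≥0∞ := ∑' k : ℤ, ENNReal.ofReal (1 / (1 + (k : ℝ) ^ 2))

lemma SS_lt : SS < ⊤ := by
  have h : Summable (fun k : ℤ => 1 / (1 + (k : ℝ) ^ 2)) := by
    have h1 : Summable (fun k : ℤ => 1 / (k : ℝ) ^ 2) := Real.summable_one_div_int_pow.2 (by norm_num)
    refine Summable.of_norm_bounded_eventually h1 ?_
    filter_upwards [Set.Finite.compl_mem_cofinite (Set.finite_singleton (0:ℤ))] with k hk
    have hk0 : (k : ℝ) ≠ 0 := by exact_mod_cast hk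
    rw [Real.norm_of_nonneg (by positivity)]
    have : 0 < (k : ℝ) ^ 2 := by positivity
    gcongr
    linarith
  exact h.tsum_ofReal_lt_top

lemma shift_sum (τ : ℝ) : ∑' n : ℤ, ENNReal.ofReal (1 / (1 + ((n : ℝ) - τ) ^ 2)) ≤ 3 * SS := by
  rw [← (Equiv.addRight ⌊τ⌋).tsum_eq, SS, ← ENNReal.tsum_mul_left]
  refine ENNReal.tsum_le_tsum fun k => ?_
  rw [show (3 : ℝ≥0∞) = ENNReal.ofReal 3 by simp, ← ENNReal.ofReal_mul (by norm_num)]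
  apply ENNReal.ofReal_le_ofReal
  have h1 := Int.floor_le τ
  have h2 := Int.lt_floor_add_one τ
  simp only [Equiv.coe_addRight]
  push_cast
  rw [mul_one_div, div_le_div_iff₀ (by positivity) (by positivity)]
  set f := τ - ⌊τ⌋
  have : (k : ℝ) + ⌊τ⌋ - τ = k - f := by simp only [f]; ring
  rw [this]
  have hf0 : 0 ≤ f := by simp only [f]; linarith
  have hf1 : f ≤ 1 := by simp only [f]; linarith
  nlinarith [sq_nonneg ((k:ℝ) - f - f), sq_nonneg ((k:ℝ) - 2 * f)]

lemma kk_sum {p : ℝ} (hp : 1 < p) : ∃ C : ℝ≥0∞, C < ⊤ ∧ ∀ t : ℝ,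
    ∑' n : ℤ, ENNReal.ofReal (kk p n t) ≤ C * ENNReal.ofReal (1 / (1 + t ^ 2)) := by
  set c : ℝ := 8 + 2 * (2 ^ p) ^ 2 with hc
  have hc0 : 0 ≤ c := by positivity
  refine ⟨ENNReal.ofReal c * (2 * SS + (3 * SS + 3 * SS)), ?_, fun t => ?_⟩
  · have := SS_lt
    refine ENNReal.mul_lt_top ENNReal.ofReal_lt_top ?_
    refine ENNReal.add_lt_top.2 ⟨ENNReal.mul_lt_top (by simp) this, ENNReal.add_lt_top.2
      ⟨ENNReal.mul_lt_top (by simp) this, ENNReal.mul_lt_top (by simp) this⟩⟩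
  set τ := |t| ^ (1 / p)
  have h1 : ∀ n : ℤ, ENNReal.ofReal (kk p n t) ≤ ENNReal.ofReal (1 / (1 + t ^ 2)) * (ENNReal.ofReal c *
      (2 * ENNReal.ofReal (1 / (1 + (n : ℝ) ^ 2)) + (ENNReal.ofReal (1 / (1 + ((n : ℝ) - τ) ^ 2)) +
        ENNReal.ofReal (1 / (1 + ((n : ℝ) - -τ) ^ 2))))) := by
    intro n
    have e1 : 0 ≤ 1 / (1 + (n : ℝ) ^ 2) := by positivity
    have e2 : 0 ≤ 1 / (1 + ((n : ℝ) - τ) ^ 2) := by positivity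
    have e3 : 0 ≤ 1 / (1 + ((n : ℝ) - -τ) ^ 2) := by positivity
    rw [← ENNReal.ofReal_add e2 e3, show (2 : ℝ≥0∞) = ENNReal.ofReal 2 by simp,
      ← ENNReal.ofReal_mul (by norm_num), ← ENNReal.ofReal_add (by positivity) (by positivity),
      ← ENNReal.ofReal_mul hc0, ← ENNReal.ofReal_mul (by positivity)]
    apply ENNReal.ofReal_le_ofReal
    rw [one_div_mul_eq_div, le_div_iff₀ (by positivity), mul_comm]
    refine (kk_bound hp n t).trans ?_
    gcongr
    · have hN := NN_one n
      have hN2 : 1 + (n : ℝ) ^ 2 ≤ 2 * NN n ^ 2 := by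
        have : |(n : ℝ)| ≤ NN n := le_max_left _ _
        rw [← sq_abs (n : ℝ)]
        have := abs_nonneg (n : ℝ)
        nlinarith
      rw [mul_one_div, div_le_div_iff₀ (by positivity) (by positivity)]
      linarith
    · rcases abs_choice (n : ℝ) with h | h
      · rw [h]; linarith
      · rw [h, show (-(n : ℝ) - τ) ^ 2 = ((n : ℝ) - -τ) ^ 2 by ring]; linarith
  refine (ENNReal.tsum_le_tsum h1).trans ?_
  rw [ENNReal.tsum_mul_left, ENNReal.tsum_mul_left, mul_comm]
  gcongr
  rw [ENNReal.tsum_add, ENNReal.tsum_add, ENNReal.tsum_mul_left]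
  gcongr
  · exact le_rfl
  · exact shift_sum τ
  · exact shift_sum (-τ)

lemma kk_point {p δ : ℝ} (hp : 1 < p) (hδ : δ < 1 / 2) (n : ℤ) {x : ℝ}
    (hx : x ∈ Icc (lam p n - δ) (lam p n + δ)) (t : ℝ) :
    (1 + |x| ^ (1 + 1 / p))⁻¹ * (NN n ^ (p - 1) / ((NN n ^ (p - 1)) ^ 2 + (t - x) ^ 2)) ≤ 12 * kk p n t := by
  set N := NN n with hN
  have hN1 : 1 ≤ N := NN_one n
  set A := N ^ (p - 1) with hA
  have hA1 : 1 ≤ A := Real.one_le_rpow hN1 (by linarith)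
  have hxl : |x - lam p n| ≤ 1 / 2 := by
    rw [abs_le]; constructor <;> linarith [hx.1, hx.2]
  have hD0 : 0 ≤ |x| ^ (1 + 1 / p) := by positivity
  have hD : N ^ 2 * A ≤ 4 * (1 + |x| ^ (1 + 1 / p)) := by
    rcases le_or_gt |(n : ℝ)| 1 with h | h
    · have : N = 1 := max_eq_right h
      rw [hA, this, Real.one_rpow]; linarith
    · have hNm : N = |(n : ℝ)| := max_eq_left h.le
      have hlx : |(n : ℝ)| ^ p - 1 / 2 ≤ |x| := by
        rw [← abs_lam hp n]
        have := abs_sub_abs_le_abs_sub (lam p n) x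
        rw [abs_sub_comm] at this
        linarith
      rw [← hNm] at hlx
      have h1 : 1 ≤ N ^ p := Real.one_le_rpow hN1 (by linarith)
      have h2 : (N ^ p / 2) ^ (1 + 1 / p) ≤ |x| ^ (1 + 1 / p) :=
        Real.rpow_le_rpow (by positivity) (by linarith) (by positivity)
      rw [Real.div_rpow (by positivity) (by norm_num), ← Real.rpow_mul (by linarith)] at h2
      have h3 : p * (1 + 1 / p) = 2 + (p - 1) := by field_simp; ring
      rw [h3, Real.rpow_add (by linarith)] at h2
      have h4 : (2 : ℝ) ^ (1 + 1 / p) ≤ 4 := by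
        calc (2 : ℝ) ^ (1 + 1 / p) ≤ 2 ^ (2 : ℝ) := by
              apply Real.rpow_le_rpow_of_exponent_le (by norm_num)
              have : 1 / p ≤ 1 := by rw [div_le_one (by linarith)]; exact hp.le
              linarith
          _ = 4 := by norm_num
      have h5 : N ^ (2 : ℝ) = N ^ 2 := by norm_cast
      rw [h5, div_le_iff₀ (by positivity)] at h2
      have : |x| ^ (1 + 1 / p) * 2 ^ (1 + 1 / p) ≤ |x| ^ (1 + 1 / p) * 4 := by gcongr
      linarith
  have hq : A ^ 2 + (lam p n - t) ^ 2 ≤ 3 * (A ^ 2 + (t - x) ^ 2) := by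
    have h1 : (x - lam p n) ^ 2 ≤ 1 / 4 := by
      rw [← sq_abs]; nlinarith [abs_nonneg (x - lam p n)]
    nlinarith [sq_nonneg ((x - lam p n) + (t - x) * 1), sq_nonneg ((x - lam p n) - (t - x) * 1)]
  have hk : kk p n t = 1 / (N ^ 2 * (A ^ 2 + (lam p n - t) ^ 2)) := rfl
  rw [hk, inv_mul_eq_div, div_div, mul_one_div, div_le_div_iff₀ (by positivity) (by positivity)]
  calc A * (N ^ 2 * (A ^ 2 + (lam p n - t) ^ 2)) = (N ^ 2 * A) * (A ^ 2 + (lam p n - t) ^ 2) := by ring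
    _ ≤ (4 * (1 + |x| ^ (1 + 1 / p))) * (3 * (A ^ 2 + (t - x) ^ 2)) := by gcongr
    _ = _ := by ring

theorem stmt19 (p δ : ℝ) (hp : 1 < p) (hδ0 : 0 < δ) (hδ : δ < 1 / 2)
    (E : Set ℝ)
    (hE : E = ⋃ n : ℤ, Icc (|(n : ℝ)| ^ p * Real.sign n - δ)
      (|(n : ℝ)| ^ p * Real.sign n + δ))
    (W : ℝ → ℝ≥0∞) (hW : IsWeight W) (hWE : ∀ x ∈ Eᶜ, W x = ⊤)
    (hnd : ¬ PolyDense W) :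
    (∫⁻ x in E, elog (MW W x) / ENNReal.ofReal (1 + |x| ^ (1 + 1 / p))) < ⊤ := by
  obtain ⟨F, K, hK, hd, hb, h0, hF⟩ := exists_F hW hnd
  obtain ⟨C, hC, hsum⟩ := kk_sum hp
  have hfin := F_poisson hK hd hb h0
  set U : ℝ → ℝ≥0∞ := fun t => nlog K (F (t + I)) with hU
  have hUc : Continuous U := by
    refine (continuous_nlog K).comp ?_
    refine hd.continuousOn.comp_continuous (by fun_prop) ?_
    intro t; simp
  have hpiece : ∀ n : ℤ, ∫⁻ x in Icc (lam p n - δ) (lam p n + δ),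
      elog (MW W x) / ENNReal.ofReal (1 + |x| ^ (1 + 1 / p)) ≤ 12 * ∫⁻ t : ℝ, ENNReal.ofReal (kk p n t) * U t := by
    intro n
    set B := 12 * ∫⁻ t : ℝ, ENNReal.ofReal (kk p n t) * U t with hB
    have hpt : ∀ x ∈ Icc (lam p n - δ) (lam p n + δ),
        elog (MW W x) / ENNReal.ofReal (1 + |x| ^ (1 + 1 / p)) ≤ B := by
      intro x hx
      have hA1 : 1 ≤ NN n ^ (p - 1) := Real.one_le_rpow (NN_one n) (by linarith)
      have h1 := MW_bound hK hF x _ hA1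
      rw [div_eq_mul_inv, mul_comm, ← ENNReal.ofReal_inv_of_pos (by positivity)]
      refine (mul_le_mul_right h1 _).trans ?_
      rw [← lintegral_const_mul' _ _ ENNReal.ofReal_ne_top, hB, ← lintegral_const_mul' _ _ (by simp)]
      refine lintegral_mono fun t => ?_
      rw [← mul_assoc, ← mul_assoc]
      refine mul_le_mul_left ?_ _
      rw [← ENNReal.ofReal_mul (by positivity), show (12 : ℝ≥0∞) = ENNReal.ofReal 12 by simp,
        ← ENNReal.ofReal_mul (by norm_num)]
      exact ENNReal.ofReal_le_ofReal (kk_point hp hδ n hx t)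
    calc _ ≤ ∫⁻ x in Icc (lam p n - δ) (lam p n + δ), B := setLIntegral_mono' measurableSet_Icc hpt
      _ = B * volume (Icc (lam p n - δ) (lam p n + δ)) := setLIntegral_const _ _
      _ ≤ B * 1 := by
        gcongr
        rw [Real.volume_Icc]
        exact ENNReal.ofReal_le_one.2 (by linarith)
      _ = B := mul_one _
  have hkm : ∀ n : ℤ, Measurable (fun t => kk p n t) := by
    intro n; unfold kk; fun_prop
  calc _ ≤ ∑' n : ℤ, ∫⁻ x in Icc (lam p n - δ) (lam p n + δ),
      elog (MW W x) / ENNReal.ofReal (1 + |x| ^ (1 + 1 / p)) := by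
        rw [hE]; exact lintegral_iUnion_le _ _
    _ ≤ ∑' n : ℤ, 12 * ∫⁻ t : ℝ, ENNReal.ofReal (kk p n t) * U t := ENNReal.tsum_le_tsum hpiece
    _ = 12 * ∫⁻ t : ℝ, ∑' n : ℤ, ENNReal.ofReal (kk p n t) * U t := by
        rw [ENNReal.tsum_mul_left, lintegral_tsum]
        intro n
        exact ((hkm n).ennreal_ofReal.mul hUc.measurable).aemeasurable
    _ ≤ 12 * ∫⁻ t : ℝ, C * (ENNReal.ofReal (1 / (1 + t ^ 2)) * U t) := by
        gcongr with t
        rw [ENNReal.tsum_mul_right, ← mul_assoc]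
        gcongr
        exact hsum t
    _ = 12 * (C * ∫⁻ t : ℝ, ENNReal.ofReal (1 / (1 + t ^ 2)) * U t) := by
        rw [lintegral_const_mul' _ _ hC.ne]
    _ < ⊤ := ENNReal.mul_lt_top (by simp) (ENNReal.mul_lt_top hC hfin)
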